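/- If G is a finite group, N ⊴ G, and χ ∈ Irr(G) has degree χ(1) coprime to |G/N|, then the restriction of χ to N is irreducible. -/

import Mathlib

open CategoryTheory Module

/-- The restriction of a finite-dimensional complex representation of `G` to a subgroup `N`. -/
noncomputable def FDRep.res {G : Type} [Group G] (N : Subgroup G) (V : FDRep ℂ G) :
    FDRep ℂ N :=
  FDRep.of (V.ρ.comp N.subtype)

theorem Matrix.isIntegral_trace_of_pow_eq_one {n : Type*} [Fintype n] [DecidableEq n]
    {A : Matrix n n ℂ} {m : ℕ} (hm : m ≠ 0) (hA : A ^ m = 1) : IsIntegral ℤ A.trace := by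
  rw [A.trace_eq_sum_roots_charpoly]
  refine (integralClosure ℤ ℂ).multiset_sum_mem fun x hx => ?_
  have hx' : x ∈ spectrum ℂ A :=
    Matrix.mem_spectrum_iff_isRoot_charpoly.2 (Polynomial.isRoot_of_mem_roots hx)
  have hpow := spectrum.pow_mem_pow A m hx'
  rw [hA] at hpow
  cases isEmpty_or_nonempty n
  · simp [Subsingleton.elim (1 : Matrix n n ℂ) 0] at hpow
  · rw [spectrum.one_eq, Set.mem_singleton_iff] at hpow
    exact IsIntegral.of_pow (Nat.pos_of_ne_zero hm) (hpow ▸ isIntegral_one)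

theorem Nat.dvd_of_isIntegral_div {a b : ℕ} (hb : b ≠ 0)
    (h : IsIntegral ℤ ((a : ℂ) / b)) : b ∣ a := by
  have h' : IsIntegral ℤ ((a : ℚ) / b) := by
    refine (isIntegral_algHom_iff (IsScalarTower.toAlgHom ℤ ℚ ℂ)
      (algebraMap ℚ ℂ).injective).1 ?_
    simpa using h
  obtain ⟨y, hy⟩ := IsIntegrallyClosed.isIntegral_iff.1 h'
  have hb' : (b : ℚ) ≠ 0 := by exact_mod_cast hb
  rw [eq_div_iff hb', eq_intCast] at hy
  have : y * (b : ℤ) = a := by exact_mod_cast hy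
  exact Int.natCast_dvd_natCast.1 ⟨y, by rw [← this, mul_comm]⟩

section ProjectiveDegree

variable {Q ι : Type*} [Group Q] [Fintype Q] [Fintype ι] [DecidableEq ι] {M : Q → Matrix ι ι ℂ}

/-- A family of invertible matrices that is multiplicative up to scalars permutes itself by
conjugation, so that sums over the group commute with the family. -/
theorem Matrix.sum_conj_commute_of_projective (hdet : ∀ q, (M q).det ≠ 0)
    (hmul : ∀ q r, ∃ c : ℂ, M q * M r = c • M (q * r)) (E : Matrix ι ι ℂ) (r : Q) :
    M r * ∑ q, M q * E * (M q)⁻¹ = (∑ q, M q * E * (M q)⁻¹) * M r := by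
  have hu : ∀ q, IsUnit (M q).det := fun q => (hdet q).isUnit
  have key : ∀ q, M r * (M q * E * (M q)⁻¹) = (M (r * q) * E * (M (r * q))⁻¹) * M r := by
    intro q
    obtain ⟨c, hc⟩ := hmul r q
    have h1 : M r = c • (M (r * q) * (M q)⁻¹) := by
      rw [← smul_mul_assoc, ← hc, Matrix.mul_assoc, Matrix.mul_nonsing_inv _ (hu q), mul_one]
    calc M r * (M q * E * (M q)⁻¹) = (M r * M q) * E * (M q)⁻¹ := by simp only [Matrix.mul_assoc]
      _ = c • (M (r * q) * E * (((M (r * q))⁻¹ * M (r * q)) * (M q)⁻¹)) := by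
        rw [hc, Matrix.nonsing_inv_mul _ (hu _), one_mul, smul_mul_assoc, smul_mul_assoc]
      _ = (M (r * q) * E * (M (r * q))⁻¹) * (c • (M (r * q) * (M q)⁻¹)) := by
        simp only [Matrix.mul_assoc, mul_smul_comm]
      _ = _ := by rw [← h1]
  rw [Finset.mul_sum, Finset.sum_mul, Finset.sum_congr rfl fun q _ => key q]
  exact Fintype.sum_equiv (Equiv.mulLeft r) _ _ fun _ => rfl

/-- Schur orthogonality for irreducible projective representations. -/
theorem Matrix.sum_trace_inv_smul_of_projective [Nonempty ι] (hdet : ∀ q, (M q).det ≠ 0)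
    (hmul : ∀ q r, ∃ c : ℂ, M q * M r = c • M (q * r))
    (hschur : ∀ P : Matrix ι ι ℂ, (∀ q, M q * P = P * M q) → ∃ c : ℂ, P = c • 1) :
    ∑ q, (M q)⁻¹.trace • M q = ((Fintype.card Q : ℂ) / Fintype.card ι) • 1 := by
  have hι : (Fintype.card ι : ℂ) ≠ 0 := by exact_mod_cast Fintype.card_ne_zero
  have hP : ∀ E : Matrix ι ι ℂ, ∑ q, M q * E * (M q)⁻¹
      = ((Fintype.card Q : ℂ) / Fintype.card ι * E.trace) • 1 := by
    intro E
    obtain ⟨c, hc⟩ := hschur _ (Matrix.sum_conj_commute_of_projective hdet hmul E)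
    have ht := congrArg Matrix.trace hc
    have : ∀ q, (M q * E * (M q)⁻¹).trace = E.trace := fun q => by
      rw [Matrix.trace_mul_comm, ← Matrix.mul_assoc,
        Matrix.nonsing_inv_mul _ (hdet q).isUnit, one_mul]
    simp only [Matrix.trace_sum, this, Finset.sum_const, Finset.card_univ, nsmul_eq_mul,
      Matrix.trace_smul, Matrix.trace_one, smul_eq_mul] at ht
    rw [hc]
    congr 1
    field_simp
    linear_combination -ht
  ext i j
  have h := fun a => congrFun (congrFun (hP (Matrix.single j a 1)) i) a
  have h2 : ∀ q a, (M q * Matrix.single j a (1 : ℂ) * (M q)⁻¹ : Matrix ι ι ℂ) i a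
      = M q i j * (M q)⁻¹ a a := by
    intro q a
    rw [Matrix.mul_apply, Finset.sum_eq_single a]
    · simp
    · intro b _ hb
      simp [hb]
    · simp
  simp only [Matrix.sum_apply, h2, Matrix.smul_apply, smul_eq_mul] at h ⊢
  simp only [Matrix.trace, Matrix.diag_apply, Finset.sum_mul]
  rw [Finset.sum_comm]
  simp only [mul_comm _ (M _ i j), h]
  rw [Finset.sum_eq_single i]
  · by_cases hij : i = j
    · subst hij
      simp
    · simp [hij, Matrix.trace_single_eq_of_ne, Ne.symm hij]
  · intro b _ hb
    simp [Matrix.one_apply_ne hb.symm]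
  · simp

/-- The degree of an irreducible projective representation, normalised to have determinant one,
divides the order of the group. -/
theorem card_dvd_card_of_projective_of_det_eq_one [Nonempty ι] (hdet : ∀ q, (M q).det = 1)
    (hmul : ∀ q r, ∃ c : ℂ, M q * M r = c • M (q * r))
    (hschur : ∀ P : Matrix ι ι ℂ, (∀ q, M q * P = P * M q) → ∃ c : ℂ, P = c • 1) :
    Fintype.card ι ∣ Fintype.card Q := by
  classical
  set n := Fintype.card ι with hn
  have hn0 : n ≠ 0 := Fintype.card_ne_zero
  have hdet0 : ∀ q, (M q).det ≠ 0 := fun q => by simp [hdet q]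
  have hmul' : ∀ q r, ∃ c : ℂ, c ^ n = 1 ∧ M q * M r = c • M (q * r) := by
    intro q r
    obtain ⟨c, hc⟩ := hmul q r
    refine ⟨c, ?_, hc⟩
    have := congrArg Matrix.det hc
    rwa [Matrix.det_mul, Matrix.det_smul, hdet, hdet, hdet, mul_one, mul_one, eq_comm] at this
  obtain ⟨d, hdn, hd⟩ : ∃ d : ℂ, d ^ n = 1 ∧ M 1 = d • 1 := by
    obtain ⟨c, hc, h⟩ := hmul' 1 1
    refine ⟨c, hc, ?_⟩
    rw [mul_one] at h
    have := congrArg (· * (M 1)⁻¹) h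
    simpa only [Matrix.mul_assoc, smul_mul_assoc, Matrix.mul_nonsing_inv _ (hdet0 1).isUnit,
      mul_one] using this
  have hpow : ∀ q (k : ℕ), ∃ c : ℂ, c ^ n = 1 ∧ M q ^ k = c • M (q ^ k) := by
    intro q k
    induction k with
    | zero =>
      have hd0 : d ≠ 0 := by rintro rfl; simp [hn0] at hdn
      refine ⟨d⁻¹, by simp [hdn], ?_⟩
      rw [pow_zero, pow_zero, hd, smul_smul, inv_mul_cancel₀ hd0, one_smul]
    | succ k ih =>
      obtain ⟨c, hc, h⟩ := ih
      obtain ⟨c', hc', h'⟩ := hmul' (q ^ k) q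
      refine ⟨c * c', by rw [mul_pow, hc, hc', one_mul], ?_⟩
      rw [pow_succ, h, smul_mul_assoc, h', smul_smul, pow_succ]
  have hfin : ∀ q, M q ^ (Fintype.card Q * n) = 1 := by
    intro q
    obtain ⟨c, hc, h⟩ := hpow q (Fintype.card Q)
    rw [pow_mul, h, pow_card_eq_one, hd, smul_smul, smul_pow, mul_pow, hc, hdn, one_pow, one_mul,
      one_smul]
  have htr : ∀ q, IsIntegral ℤ (M q)⁻¹.trace := fun q =>
    Matrix.isIntegral_trace_of_pow_eq_one (mul_ne_zero Fintype.card_ne_zero hn0)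
      (by rw [Matrix.inv_pow', hfin, inv_one])
  let R := integralClosure ℤ ℂ
  let L : Submodule R (Matrix ι ι ℂ) := Submodule.span R (Set.range M)
  have hL : ∀ q, ∀ X ∈ L, M q * X ∈ L := by
    intro q X hX
    induction hX using Submodule.span_induction with
    | mem x hx =>
      obtain ⟨r, rfl⟩ := hx
      obtain ⟨c, hc, h⟩ := hmul' q r
      have hcR : IsIntegral ℤ c := IsIntegral.of_pow (Nat.pos_of_ne_zero hn0) (hc ▸ isIntegral_one)
      rw [h]
      exact L.smul_mem (⟨c, hcR⟩ : R) (Submodule.subset_span ⟨_, rfl⟩)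
    | zero => simp
    | add x y _ _ hx hy => rw [mul_add]; exact L.add_mem hx hy
    | smul a x _ hx => rw [mul_smul_comm]; exact L.smul_mem a hx
  have hsum := Matrix.sum_trace_inv_smul_of_projective hdet0 hmul hschur
  have hint : IsIntegral R ((Fintype.card Q : ℂ) / n) := by
    refine isIntegral_of_smul_mem_submodule L ?_ (Submodule.fg_span (Set.finite_range M)) _ ?_
    · refine (Submodule.ne_bot_iff _).2 ⟨M 1, Submodule.subset_span ⟨1, rfl⟩, fun h => hdet0 1 ?_⟩
      rw [h, Matrix.det_zero]
    · intro X hX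
      have : ((Fintype.card Q : ℂ) / n) • X = ∑ q, (⟨_, htr q⟩ : R) • (M q * X) := by
        rw [← one_mul X, ← smul_mul_assoc, ← hsum, Finset.sum_mul]
        simp only [one_mul, smul_mul_assoc]
        rfl
      rw [this]
      exact L.sum_mem fun q _ => L.smul_mem _ (hL q X hX)
  exact Nat.dvd_of_isIntegral_div hn0 (isIntegral_trans (A := R) _ hint)

/-- The degree of an irreducible projective representation divides the order of the group. -/
theorem card_dvd_card_of_projective [Nonempty ι] (hdet : ∀ q, (M q).det ≠ 0)
    (hmul : ∀ q r, ∃ c : ℂ, M q * M r = c • M (q * r))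
    (hschur : ∀ P : Matrix ι ι ℂ, (∀ q, M q * P = P * M q) → ∃ c : ℂ, P = c • 1) :
    Fintype.card ι ∣ Fintype.card Q := by
  choose c hc using fun q =>
    IsAlgClosed.exists_pow_nat_eq (M q).det (Fintype.card_pos (α := ι))
  have hc0 : ∀ q, c q ≠ 0 := fun q h => hdet q (by rw [← hc q, h, zero_pow Fintype.card_ne_zero])
  refine card_dvd_card_of_projective_of_det_eq_one (M := fun q => (c q)⁻¹ • M q) ?_ ?_ ?_
  · intro q
    rw [Matrix.det_smul, inv_pow, hc, inv_mul_cancel₀ (hdet q)]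
  · intro q r
    obtain ⟨k, hk⟩ := hmul q r
    refine ⟨(c q)⁻¹ * (c r)⁻¹ * k * c (q * r), ?_⟩
    rw [smul_mul_assoc, mul_smul_comm, hk, smul_smul, smul_smul, smul_smul, mul_assoc _ (c _),
      mul_inv_cancel₀ (hc0 _), mul_one]
  · intro P hP
    refine hschur P fun q => ?_
    have := congrArg (c q • ·) (hP q)
    simpa only [smul_mul_assoc, mul_smul_comm, smul_smul, mul_inv_cancel₀ (hc0 q), one_smul]
      using this

end ProjectiveDegree

section
variable {ι U : Type*} [Fintype ι] [AddCommGroup U] [Module ℂ U]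

/-- `f` is the tensor product `A ⊗ β`, acting on `ι → U = (ι → ℂ) ⊗ U`. -/
def IsMatrixTensor (f : End ℂ (ι → U)) (A : Matrix ι ι ℂ) (β : U ≃ₗ[ℂ] U) : Prop :=
  ∀ v i, f v i = ∑ j, A i j • β (v j)

namespace IsMatrixTensor

variable {f g : End ℂ (ι → U)} {A B : Matrix ι ι ℂ} {β γ : U ≃ₗ[ℂ] U}

theorem mul (hf : IsMatrixTensor f A β) (hg : IsMatrixTensor g B γ) :
    IsMatrixTensor (f * g) (A * B) (γ.trans β) := by
  intro v i
  rw [Module.End.mul_apply, hf]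
  simp only [hg v, map_sum, map_smul, Finset.smul_sum, smul_smul, Matrix.mul_apply, Finset.sum_smul,
    LinearEquiv.trans_apply]
  exact Finset.sum_comm

theorem one_left [DecidableEq ι] (hf : ∀ v i, f v i = β (v i)) : IsMatrixTensor f 1 β := by
  intro v i
  simp [hf, Matrix.one_apply]

theorem det_ne_zero [DecidableEq ι] [Nontrivial U] (hf : IsMatrixTensor f A β)
    (hinj : Function.Injective f) : A.det ≠ 0 := by
  intro h
  obtain ⟨w, hw, hAw⟩ := Matrix.exists_mulVec_eq_zero_iff.2 h
  obtain ⟨u, hu⟩ := exists_ne (0 : U)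
  refine hw (funext fun j => ?_)
  have h0 : f (fun j => w j • u) = 0 := by
    funext i
    have := congrFun hAw i
    simp only [Matrix.mulVec, dotProduct, Pi.zero_apply] at this
    simp only [hf _ i, map_smul, smul_smul, ← Finset.sum_smul, this, zero_smul, Pi.zero_apply]
  have := congrFun (hinj (h0.trans (map_zero f).symm)) j
  simpa [hu] using this

theorem smul_eq_smul (hf : IsMatrixTensor f A β) (hf' : IsMatrixTensor f B γ) (i j : ι) (u : U) :
    A i j • β u = B i j • γ u := by
  classical
  have h := (hf (Pi.single j u) i).symm.trans (hf' (Pi.single j u) i)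
  rw [Finset.sum_eq_single j, Finset.sum_eq_single j] at h
  · simpa using h
  all_goals simp +contextual [Pi.single_eq_of_ne]

theorem eq_smul [Nontrivial U] (hf : IsMatrixTensor f A β) (hf' : IsMatrixTensor f B γ)
    (hB : B ≠ 0) : ∃ c : ℂ, A = c • B := by
  have key := hf.smul_eq_smul hf'
  obtain ⟨k, l, hkl⟩ : ∃ k l, B k l ≠ 0 := by
    by_contra! h
    exact hB (Matrix.ext h)
  have hγ : ∀ u, γ u = ((B k l)⁻¹ * A k l) • β u := fun u => by
    rw [mul_smul, key, smul_smul, inv_mul_cancel₀ hkl, one_smul]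
  obtain ⟨u, hu⟩ := exists_ne (0 : U)
  have hβu : β u ≠ 0 := by simpa using hu
  have hAB : ∀ i j, A i j = ((B k l)⁻¹ * A k l) * B i j := fun i j => by
    have := key i j u
    rw [hγ, smul_smul] at this
    rw [smul_left_injective ℂ hβu this, mul_comm]
  exact ⟨_, Matrix.ext hAB⟩

end IsMatrixTensor

end

namespace Representation

theorem IsIrreducible.exists_eq_smul_id {H U : Type*} [Monoid H] [AddCommGroup U] [Module ℂ U]
    [FiniteDimensional ℂ U] (τ : Representation ℂ H U) [τ.IsIrreducible] (f : End ℂ U)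
    (hf : ∀ h, f ∘ₗ τ h = τ h ∘ₗ f) : ∃ c : ℂ, f = c • LinearMap.id := by
  let F : IntertwiningMap τ τ := ⟨f, hf⟩
  obtain ⟨c, hc⟩ := (IsIrreducible.algebraMap_intertwiningMap_bijective_of_isAlgClosed (ρ := τ)).2 F
  refine ⟨c, ?_⟩
  have := congrArg IntertwiningMap.toLinearMap hc
  exact this.symm

theorem IsIrreducible.nontrivial {H U : Type*} [Monoid H] [AddCommGroup U] [Module ℂ U]
    (τ : Representation ℂ H U) [τ.IsIrreducible] : Nontrivial U := by
  by_contra h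
  rw [not_nontrivial_iff_subsingleton] at h
  refine bot_ne_top (α := Subrepresentation τ) ?_
  exact Subrepresentation.toSubmodule_injective (Subsingleton.elim _ _)

/-- A nonzero map semilinear with respect to an endomorphism of the group is injective. -/
theorem IsIrreducible.injective_of_twisted {H U : Type*} [Monoid H] [AddCommGroup U] [Module ℂ U]
    (τ : Representation ℂ H U) [τ.IsIrreducible] (σ : H → H) (f : End ℂ U)
    (hf : ∀ h u, f (τ h u) = τ (σ h) (f u)) (hf0 : f ≠ 0) : Function.Injective f := by
  let K : Subrepresentation τ := ⟨LinearMap.ker f, fun h v hv => by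
    rw [LinearMap.mem_ker] at hv ⊢
    rw [hf, hv, map_zero]⟩
  rcases eq_bot_or_eq_top K with h | h
  · exact LinearMap.ker_eq_bot.1 (congrArg Subrepresentation.toSubmodule h)
  · exact absurd (LinearMap.ker_eq_top.1 (congrArg Subrepresentation.toSubmodule h)) hf0

section

variable {G ι U : Type*} [Group G] [Fintype ι] [Nonempty ι] [AddCommGroup U] [Module ℂ U]
  [FiniteDimensional ℂ U] (N : Subgroup G) [hN : N.Normal] (τ : Representation ℂ N U)
  [τ.IsIrreducible] (ρ : Representation ℂ G (ι → U))

theorem exists_isMatrixTensor (hρ : ∀ (n : N) v i, ρ n v i = τ n (v i)) (g : G) :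
    ∃ A β, IsMatrixTensor (ρ g) A β := by
  classical
  have := IsIrreducible.nontrivial τ
  let b : ι → ι → End ℂ U := fun i j => LinearMap.proj i ∘ₗ ρ g ∘ₗ LinearMap.single ℂ (fun _ => U) j
  have hsum : ∀ v i, ρ g v i = ∑ j, b i j (v j) := by
    intro v i
    conv_lhs => rw [← Finset.univ_sum_single v, map_sum, Finset.sum_apply]
    rfl
  have hb : ∀ i j (n : N) u, b i j (τ n u) = τ (MulAut.conjNormal g n) (b i j u) := by
    intro i j n u
    have h1 : (Pi.single j (τ n u) : ι → U) = ρ n (Pi.single j u) := by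
      funext k
      rw [hρ]
      by_cases hk : k = j
      · subst hk; simp
      · simp [hk]
    change ρ g (Pi.single j (τ n u)) i = τ _ (ρ g (Pi.single j u) i)
    rw [h1, ← hρ, ← Module.End.mul_apply, ← Module.End.mul_apply, ← map_mul, ← map_mul,
      MulAut.conjNormal_apply, inv_mul_cancel_right]
  obtain ⟨k, l, hkl⟩ : ∃ k l, b k l ≠ 0 := by
    by_contra! h
    obtain ⟨u, hu⟩ := exists_ne (0 : U)
    have h0 : ρ g (fun _ => u) = 0 := by
      funext i
      simp [hsum, h]
    have h1 := congrArg (ρ g⁻¹) h0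
    rw [← Module.End.mul_apply, ← map_mul, inv_mul_cancel, map_one, map_zero] at h1
    exact hu (congrFun h1 (Classical.arbitrary ι))
  have hinj := IsIrreducible.injective_of_twisted τ _ _ (hb k l) hkl
  let β : U ≃ₗ[ℂ] U := LinearEquiv.ofInjectiveEndo _ hinj
  have hβ : ∀ u, β u = b k l u := fun _ => rfl
  have hc : ∀ i j, ∃ c : ℂ, (β.symm : U →ₗ[ℂ] U) ∘ₗ b i j = c • LinearMap.id := by
    intro i j
    refine IsIrreducible.exists_eq_smul_id τ _ fun n => LinearMap.ext fun u => ?_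
    simp only [LinearMap.comp_apply, LinearEquiv.coe_coe]
    rw [LinearEquiv.symm_apply_eq, hβ, hb, hb, ← hβ, LinearEquiv.apply_symm_apply]
  choose A hA using hc
  refine ⟨Matrix.of A, β, fun v i => ?_⟩
  rw [hsum]
  refine Finset.sum_congr rfl fun j _ => ?_
  have := LinearMap.congr_fun (hA i j) (v j)
  simp only [LinearMap.comp_apply, LinearEquiv.coe_coe, LinearMap.smul_apply,
    LinearMap.id_apply] at this
  rw [LinearEquiv.symm_apply_eq, map_smul] at this
  exact this

theorem card_dvd_index_of_isotypic [Finite G] (hρ : ∀ (n : N) v i, ρ n v i = τ n (v i))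
    (hschur : ∀ f : End ℂ (ι → U), (∀ g, f ∘ₗ ρ g = ρ g ∘ₗ f) → ∃ c : ℂ, f = c • LinearMap.id) :
    Fintype.card ι ∣ N.index := by
  classical
  have := IsIrreducible.nontrivial τ
  have := Fintype.ofFinite (G ⧸ N)
  choose A β hA using exists_isMatrixTensor N τ ρ hρ
  have hinj : ∀ g, Function.Injective (ρ g) := fun g =>
    Function.LeftInverse.injective (g := ρ g⁻¹) fun v => by
      rw [← Module.End.mul_apply, ← map_mul, inv_mul_cancel, map_one, Module.End.one_apply]
  have hdet : ∀ g, (A g).det ≠ 0 := fun g => (hA g).det_ne_zero (hinj g)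
  have hne : ∀ g, A g ≠ 0 := fun g h => hdet g (by rw [h, Matrix.det_zero])
  have hτ : ∀ n : N, ∃ γ, IsMatrixTensor (ρ n) 1 γ := by
    intro n
    refine ⟨LinearEquiv.ofInjectiveEndo (τ n) ?_, .one_left fun v i => hρ n v i⟩
    exact Function.LeftInverse.injective (g := τ n⁻¹) fun v => by
      rw [← Module.End.mul_apply, ← map_mul, inv_mul_cancel, map_one, Module.End.one_apply]
  have hcoset : ∀ g : G, ∃ c : ℂ, A g = c • A (g : G ⧸ N).out := by
    intro g
    obtain ⟨n, hn⟩ := QuotientGroup.mk_out_eq_mul N g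
    obtain ⟨γ, hγ⟩ := hτ n
    have h := (hA g).mul hγ
    rw [← map_mul, ← hn, mul_one] at h
    exact h.eq_smul (hA _) (hne _)
  rw [Subgroup.index_eq_card, Nat.card_eq_fintype_card]
  refine card_dvd_card_of_projective (M := fun q : G ⧸ N => A q.out) (fun q => hdet _) ?_ ?_
  · intro q r
    have h := (hA q.out).mul (hA r.out)
    rw [← map_mul] at h
    obtain ⟨c, hc⟩ := h.eq_smul (hA _) (hne _)
    obtain ⟨d, hd⟩ := hcoset (q.out * r.out)
    refine ⟨c * d, ?_⟩
    rw [hc, hd, smul_smul, QuotientGroup.mk_mul, QuotientGroup.out_eq', QuotientGroup.out_eq']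
  · intro P hP
    let f : End ℂ (ι → U) :=
      LinearMap.pi fun i => ∑ j, P i j • LinearMap.proj j
    have hf : IsMatrixTensor f P (LinearEquiv.refl ℂ U) := by
      intro v i
      simp [f, LinearMap.sum_apply]
    have hcomm : ∀ g, A g * P = P * A g := by
      intro g
      obtain ⟨c, hc⟩ := hcoset g
      rw [hc, smul_mul_assoc, hP, mul_smul_comm]
    obtain ⟨c, hc⟩ := hschur f fun g => by
      refine LinearMap.ext fun v => funext fun i => ?_
      have h1 := (hf.mul (hA g)) v i
      have h2 := ((hA g).mul hf) v i
      rw [hcomm] at h2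
      exact h1.trans h2.symm
    have hf' : IsMatrixTensor f (c • 1) (LinearEquiv.refl ℂ U) := by
      intro v i
      simp [hc, Matrix.one_apply]
    obtain ⟨u, hu⟩ := exists_ne (0 : U)
    exact ⟨c, Matrix.ext fun i j => smul_left_injective ℂ hu (hf.smul_eq_smul hf' i j u)⟩

end

end Representation

section Clifford

variable {k A M G : Type*} [Field k] [Ring A] [AddCommGroup M] [Module k M]
  [Module A M] [Group G] (r : Representation k G M)

theorem Representation.apply_inv_apply (g : G) (m : M) : r g (r g⁻¹ m) = m := by
  rw [← Module.End.mul_apply, ← map_mul, mul_inv_cancel, map_one, Module.End.one_apply]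

theorem Representation.inv_apply_apply (g : G) (m : M) : r g⁻¹ (r g m) = m := by
  rw [← Module.End.mul_apply, ← map_mul, inv_mul_cancel, map_one, Module.End.one_apply]

variable (hA : ∀ g (a : A), ∃ b : A, ∀ m, r g (a • m) = b • r g m)

/-- The action on `A`-submodules of a group of linear maps that normalises the action of `A`. -/
@[reducible] def submoduleMulActionOfNormalizes : MulAction G (Submodule A M) where
  smul g S :=
    { carrier := {m | r g⁻¹ m ∈ S}
      add_mem' := fun {x y} hx hy => by
        rw [Set.mem_ofPred_eq, map_add]
        exact S.add_mem hx hy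
      zero_mem' := by
        rw [Set.mem_ofPred_eq, map_zero]
        exact S.zero_mem
      smul_mem' := fun a m hm => by
        obtain ⟨b, hb⟩ := hA g⁻¹ a
        rw [Set.mem_ofPred_eq, hb]
        exact S.smul_mem b hm }
  one_smul S := by
    ext m
    change r 1⁻¹ m ∈ S ↔ m ∈ S
    rw [inv_one, map_one, Module.End.one_apply]
  mul_smul g h S := by
    ext m
    change r (g * h)⁻¹ m ∈ S ↔ r h⁻¹ (r g⁻¹ m) ∈ S
    rw [mul_inv_rev, map_mul, Module.End.mul_apply]

include hA in
theorem Submodule.IsFullyInvariant.of_normalizes {S T : Submodule A M} (hS : S.IsFullyInvariant)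
    (g : G) (hT : ∀ m, m ∈ T ↔ r g⁻¹ m ∈ S) : T.IsFullyInvariant := by
  intro f m hm
  let h : M →ₗ[A] M :=
    { toFun := fun x => r g⁻¹ (f (r g x))
      map_add' := fun x y => by simp only [map_add]
      map_smul' := fun a x => by
        obtain ⟨b, hb⟩ := hA g a
        rw [hb, map_smul, RingHom.id_apply]
        nth_rewrite 1 [← r.apply_inv_apply g (f (r g x))]
        rw [← hb, r.inv_apply_apply] }
  have := hS h ((hT m).1 hm)
  rw [Submodule.mem_comap] at this ⊢
  rw [hT]
  change r g⁻¹ (f (r g (r g⁻¹ m))) ∈ S at this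
  rwa [r.apply_inv_apply] at this

include hA in
theorem mem_isotypicComponents_of_normalizes [IsSemisimpleModule A M] {S T : Submodule A M}
    (hS : S ∈ isotypicComponents A M) (g : G) (hT : ∀ m, m ∈ T ↔ r g⁻¹ m ∈ S) :
    T ∈ isotypicComponents A M := by
  let _ := submoduleMulActionOfNormalizes r hA
  have hmem : ∀ (g : G) (S : Submodule A M) m, m ∈ g • S ↔ r g⁻¹ m ∈ S := fun _ _ _ => Iff.rfl
  have hmono : ∀ (g : G) {S T : Submodule A M}, S ≤ T → g • S ≤ g • T :=
    fun g S T h m hm => h hm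
  obtain rfl : T = g • S := Submodule.ext hT
  have hbot : g • S ≠ ⊥ := by
    intro h
    refine (bot_lt_isotypicComponents hS).ne' ?_
    rw [← inv_smul_smul g S, h, eq_bot_iff]
    intro m hm
    rw [hmem, Submodule.mem_bot] at hm
    rw [Submodule.mem_bot, ← r.apply_inv_apply g⁻¹ m, hm, map_zero]
  obtain ⟨U, hU, hUs⟩ := (IsSemisimpleModule.eq_bot_or_exists_simple_le (g • S)).resolve_left hbot
  have hle : isotypicComponent A M U ≤ g • S :=
    isFullyInvariant_iff_le_imp_isotypicComponent_le.1
      ((Submodule.IsFullyInvariant.of_mem_isotypicComponents hS).of_normalizes r hA g hT) U hU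
  refine ⟨U, hUs, le_antisymm ?_ hle⟩
  set C := isotypicComponent A M U with hC
  have hCinv : (g⁻¹ • C).IsFullyInvariant :=
    (Submodule.IsFullyInvariant.isotypicComponent A M U).of_normalizes r hA g⁻¹ (hmem _ _)
  have hCle : g⁻¹ • C ≤ S := by simpa using hmono g⁻¹ hle
  have hCbot : g⁻¹ • C ≠ ⊥ := by
    intro h
    refine (bot_lt_isotypicComponent U).ne' ?_
    rw [← hC, eq_bot_iff]
    intro m hm
    have : r g⁻¹ m ∈ g⁻¹ • C := by
      rwa [hmem, r.inv_apply_apply]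
    rw [h, Submodule.mem_bot] at this
    rw [Submodule.mem_bot, ← r.apply_inv_apply g m, this, map_zero]
  obtain ⟨W, hW, hWs⟩ := (IsSemisimpleModule.eq_bot_or_exists_simple_le _).resolve_left hCbot
  have h1 := isFullyInvariant_iff_le_imp_isotypicComponent_le.1 hCinv W hW
  rw [← eq_isotypicComponent_of_le hS (hW.trans hCle)] at h1
  simpa using hmono g h1

variable [Algebra k A] [IsScalarTower k A M]

theorem finrank_eq_card_mul_of_iSupIndep [FiniteDimensional k M] {ι : Type*} [Fintype ι]
    {p : ι → Submodule A M} (hp : iSupIndep p) (htop : ⨆ i, p i = ⊤) {d : ℕ}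
    (hd : ∀ i, finrank k (p i) = d) : finrank k M = Fintype.card ι * d := by
  classical
  have (i : ι) : FiniteDimensional k (p i) :=
    inferInstanceAs (FiniteDimensional k ((p i).restrictScalars k))
  let e : ((i : ι) → p i) ≃ₗ[k] M :=
    ((DFinsupp.linearEquivFunOnFintype (R := A)).symm.trans (hp.linearEquiv htop)).restrictScalars k
  rw [← e.finrank_eq, Module.finrank_pi_fintype]
  simp [hd]

include hA in
/-- An irreducible representation normalising the action of `A` is `A`-isotypic if its dimension is
coprime to the index of a subgroup acting through `A`. -/
theorem isIsotypic_of_coprime_finrank_index [Finite G] [FiniteDimensional k M]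
    [IsSemisimpleModule A M] [r.IsIrreducible] (K : Subgroup G)
    (hK : ∀ g ∈ K, ∃ a : A, ∀ m, r g m = a • m) (hcop : Nat.Coprime (finrank k M) K.index) :
    IsIsotypic A M := by
  classical
  let _ := submoduleMulActionOfNormalizes r hA
  have hmem : ∀ (g : G) (S : Submodule A M) m, m ∈ g • S ↔ r g⁻¹ m ∈ S := fun _ _ _ => Iff.rfl
  have hmono : ∀ (g : G) {S T : Submodule A M}, S ≤ T → g • S ≤ g • T :=
    fun g S T h m hm => h hm
  intro U hU
  set C := isotypicComponent A M U with hC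
  have hCmem : C ∈ isotypicComponents A M := ⟨U, hU, rfl⟩
  let O := MulAction.orbit G C
  have hO : O ⊆ isotypicComponents A M := by
    rintro _ ⟨g, rfl⟩
    exact mem_isotypicComponents_of_normalizes r hA hCmem g (hmem g C)
  have hfin : Finite O := Set.finite_range _
  have := Fintype.ofFinite O
  have hind : iSupIndep (fun S : O => (S : Submodule A M)) :=
    (sSupIndep_iff _).1 ((sSupIndep_isotypicComponents A M).mono hO)
  have hinv : ∀ g : G, g • sSup O ≤ sSup O := by
    intro g
    have h : sSup O ≤ g⁻¹ • sSup O := sSup_le fun S hS => by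
      have hgS : g • S ∈ O := MulAction.mem_orbit_of_mem_orbit g hS
      simpa using hmono g⁻¹ (le_sSup hgS)
    simpa using hmono g h
  have htop : ⨆ S : O, (S : Submodule A M) = ⊤ := by
    rw [← sSup_eq_iSup']
    let W : Subrepresentation r := ⟨(sSup O).restrictScalars k, fun g v hv =>
      hinv g (by rw [hmem]; rwa [r.inv_apply_apply])⟩
    have hW : W ≠ ⊥ := by
      intro h
      refine (bot_lt_isotypicComponent U).ne' (eq_bot_iff.2 ?_)
      have h' : (sSup O).restrictScalars k = ⊥ := congrArg Subrepresentation.toSubmodule h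
      rw [Submodule.restrictScalars_eq_bot_iff] at h'
      rw [← h']
      exact le_sSup (MulAction.mem_orbit_self C)
    have h' : (sSup O).restrictScalars k = ⊤ :=
      congrArg Subrepresentation.toSubmodule ((eq_bot_or_eq_top W).resolve_left hW)
    rwa [Submodule.restrictScalars_eq_top_iff] at h'
  have hd : ∀ S : O, finrank k (S : Submodule A M) = finrank k C := by
    rintro ⟨_, g, rfl⟩
    refine LinearEquiv.finrank_eq (LinearEquiv.ofLinearMap
      ((r g⁻¹).restrict (p := (g • C).restrictScalars k) (q := C.restrictScalars k) fun m hm => hm)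
      ((r g).restrict (p := C.restrictScalars k) (q := (g • C).restrictScalars k) fun m hm => ?_)
      ?_ ?_)
    · change r g⁻¹ (r g m) ∈ C
      rwa [r.inv_apply_apply]
    · ext m
      exact r.inv_apply_apply g m
    · ext m
      exact r.apply_inv_apply g m
  have hcard := finrank_eq_card_mul_of_iSupIndep (k := k) hind htop hd
  have hdvd : Fintype.card O ∣ K.index := by
    rw [← Nat.card_eq_fintype_card, Nat.card_coe_set_eq, ← MulAction.index_stabilizer]
    refine Subgroup.index_dvd_of_le fun g hg => ?_
    have hle : ∀ g ∈ K, C ≤ g • C := fun g hg m hm => by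
      obtain ⟨a, ha⟩ := hK g⁻¹ (K.inv_mem hg)
      rw [hmem, ha]
      exact C.smul_mem a hm
    refine le_antisymm ?_ (hle g hg)
    simpa using hmono g (hle g⁻¹ (K.inv_mem hg))
  have hone : Fintype.card O = 1 :=
    Nat.eq_one_of_dvd_coprimes hcop (hcard ▸ dvd_mul_right _ _) hdvd
  have hCtop : C = ⊤ := by
    have := Fintype.card_le_one_iff_subsingleton.1 hone.le
    rw [← htop, ciSup_subsingleton (⟨C, MulAction.mem_orbit_self C⟩ : O)]
  exact IsIsotypicOfType.of_isotypicComponent_eq_top hCtop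

end Clifford

theorem FDRep.isIrreducible_of_simple {k G : Type} [Field k] [Group G] (V : FDRep k G) [Simple V] :
    Representation.IsIrreducible (V.ρ : Representation k G V) := by
  have : Nontrivial V := by
    by_contra h
    rw [not_nontrivial_iff_subsingleton] at h
    apply id_nonzero V
    ext x
    exact Subsingleton.elim _ _
  have : Nontrivial (Subrepresentation (V.ρ : Representation k G V)) := ⟨⊥, ⊤, fun h =>
    bot_ne_top (α := Submodule k V) (congrArg Subrepresentation.toSubmodule h)⟩
  refine ⟨fun W => or_iff_not_imp_left.2 fun hW => ?_⟩
  let f : FDRep.of W.toRepresentation ⟶ V :=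
    ⟨InducedCategory.homMk (ModuleCat.ofHom W.toSubmodule.subtype), fun g => rfl⟩
  have hf : ∀ x, f x = W.toSubmodule.subtype x := fun x => rfl
  have : Mono f := ConcreteCategory.mono_of_injective _ W.toSubmodule.subtype_injective
  have hf0 : f ≠ 0 := by
    intro h
    refine hW (Subrepresentation.toSubmodule_injective (eq_bot_iff.2 fun x hx => ?_))
    have : f ⟨x, hx⟩ = 0 := by rw [h]; rfl
    exact this
  have := isIso_of_mono_of_nonzero hf0
  refine Subrepresentation.toSubmodule_injective (eq_top_iff.2 fun x _ => ?_)
  let e := FDRep.isoToLinearEquiv (asIso f)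
  rw [← e.apply_symm_apply x]
  exact (e.symm x).2

theorem FDRep.simple_of_isIrreducible {k G V : Type} [Field k] [IsAlgClosed k] [Group G] [Finite G]
    [NeZero (Nat.card G : k)] [AddCommGroup V] [Module k V] [FiniteDimensional k V]
    (ρ : Representation k G V) [ρ.IsIrreducible] : Simple (FDRep.of ρ) := by
  rw [simple_iff_end_is_rank_one, ← (forget₂HomLinearEquiv _ _).finrank_eq]
  rw [← Representation.IsIrreducible.finrank_intertwiningMap_self ρ]
  exact (Rep.homLinearEquiv ((forget₂ (FDRep k G) (Rep k G)).obj (FDRep.of ρ)) _).finrank_eq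

open scoped MonoidAlgebra in
/-- The subrepresentation attached to a simple submodule is irreducible. -/
theorem Subrepresentation.isIrreducible_toRepresentation {k G V : Type*} [Field k] [Monoid G]
    [AddCommGroup V] [Module k V] {ρ : Representation k G V} (S : Submodule k[G] ρ.asModule)
    [hS : IsSimpleModule k[G] S] :
    (Subrepresentation.ofSubmodule' S).toRepresentation.IsIrreducible := by
  let W := Subrepresentation.ofSubmodule' S
  have hatom : IsAtom W :=
    ((subrepresentationSubmoduleOrderIso (ρ := ρ)).symm.isAtom_iff S).2
      (isSimpleModule_iff_isAtom.1 hS)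
  have : Nontrivial W.toSubmodule := Submodule.nontrivial_iff_ne_bot.2 fun h =>
    hatom.1 (toSubmodule_injective h)
  have : Nontrivial (Subrepresentation W.toRepresentation) := ⟨⊥, ⊤, fun h =>
    bot_ne_top (α := Submodule k W.toSubmodule) (congrArg toSubmodule h)⟩
  refine ⟨fun T => ?_⟩
  let T' : Subrepresentation ρ := ⟨T.toSubmodule.map W.toSubmodule.subtype, fun g v hv => by
    obtain ⟨t, ht, rfl⟩ := hv
    exact ⟨_, T.apply_mem_toSubmodule g ht, rfl⟩⟩
  have hT' : T' ≤ W := fun v hv => by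
    obtain ⟨t, -, rfl⟩ := hv
    exact t.2
  refine (hatom.le_iff.1 hT').imp (fun h => toSubmodule_injective ?_)
    (fun h => toSubmodule_injective ?_)
  · have h : T.toSubmodule.map W.toSubmodule.subtype = ⊥ := congrArg toSubmodule h
    exact Submodule.map_injective_of_injective W.toSubmodule.subtype_injective
      (h.trans (Submodule.map_bot _).symm)
  · have h : T.toSubmodule.map W.toSubmodule.subtype = W.toSubmodule := congrArg toSubmodule h
    exact Submodule.map_injective_of_injective W.toSubmodule.subtype_injective
      (h.trans (Submodule.map_subtype_top _).symm)

open scoped MonoidAlgebra in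
/-- The restriction of an irreducible complex representation to a normal subgroup of index coprime
to its dimension is irreducible. -/
theorem Representation.isIrreducible_comp_subtype_of_coprime {G V : Type*} [Group G] [Finite G]
    (N : Subgroup G) [N.Normal] [AddCommGroup V] [Module ℂ V] [FiniteDimensional ℂ V]
    (ρ : Representation ℂ G V) [ρ.IsIrreducible]
    (hcop : Nat.Coprime (finrank ℂ V) N.index) :
    Representation.IsIrreducible (ρ.comp N.subtype : Representation ℂ N V) := by
  let σ : Representation ℂ N V := ρ.comp N.subtype
  let r : Representation ℂ G σ.asModule := ρ
  have hr : r.IsIrreducible := ‹ρ.IsIrreducible›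
  have hK : ∀ g (hg : g ∈ N) m, r g m = MonoidAlgebra.single (⟨g, hg⟩ : N) (1 : ℂ) • m := by
    intro g hg m
    rw [single_smul, one_smul]
    rfl
  have hA : ∀ g (a : ℂ[N]), ∃ b : ℂ[N], ∀ m, r g (a • m) = b • r g m := by
    intro g a
    induction a using MonoidAlgebra.induction_linear with
    | zero => exact ⟨0, fun m => by rw [zero_smul, zero_smul, map_zero]⟩
    | add a b ha hb =>
      obtain ⟨a', ha⟩ := ha
      obtain ⟨b', hb⟩ := hb
      exact ⟨a' + b', fun m => by rw [add_smul, add_smul, map_add, ha, hb]⟩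
    | single n c =>
      have hcomm : ∀ v, ρ g (c • ρ n v) = c • ρ (MulAut.conjNormal g n : N) (ρ g v) := fun v => by
        rw [map_smul, ← Module.End.mul_apply, ← Module.End.mul_apply, ← map_mul, ← map_mul,
          MulAut.conjNormal_apply, inv_mul_cancel_right]
      refine ⟨MonoidAlgebra.single (MulAut.conjNormal g n) c, fun m => ?_⟩
      rw [single_smul, single_smul]
      exact hcomm m
  have : FiniteDimensional ℂ σ.asModule := ‹FiniteDimensional ℂ V›
  have : Nontrivial σ.asModule := hr.nontrivial
  have : Module.Finite ℂ[N] σ.asModule := Module.Finite.of_restrictScalars_finite ℂ _ _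
  obtain ⟨n, hn, S, hS, ⟨e⟩⟩ := (isIsotypic_of_coprime_finrank_index r hA N
    (fun g hg => ⟨_, hK g hg⟩) hcop).linearEquiv_fun
  let W := Subrepresentation.ofSubmodule' S
  have hW : W.toRepresentation.IsIrreducible := Subrepresentation.isIrreducible_toRepresentation S
  let e' : V ≃ₗ[ℂ] (Fin n → W.toSubmodule) := e.restrictScalars ℂ
  let ρ' : Representation ℂ G (Fin n → W.toSubmodule) := e'.conjRingEquiv.toMonoidHom.comp ρ
  have hρ' : ∀ g v, ρ' g v = e' (ρ g (e'.symm v)) := fun g v => rfl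
  have he' : ∀ (h : N) v i, e' (ρ h v) i = W.toRepresentation h (e' v i) := by
    intro h v i
    have h1 : e (r h v) = MonoidAlgebra.single h (1 : ℂ) • e v :=
      (congrArg e (hK h h.2 v)).trans (e.map_smul _ _)
    refine (congrFun h1 i).trans (Subtype.ext ?_)
    exact (hK h h.2 _).symm
  have hdvd : n ∣ N.index := by
    rw [← Fintype.card_fin n]
    refine card_dvd_index_of_isotypic N W.toRepresentation ρ' (fun h v i => ?_) fun f hf => ?_
    · rw [hρ', he', e'.apply_symm_apply]
    · obtain ⟨c, hc⟩ := IsIrreducible.exists_eq_smul_id ρ (e'.symm.conj f) fun g => by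
        ext v
        have := congrArg e'.symm (LinearMap.congr_fun (hf g) (e' v))
        simpa [hρ', LinearEquiv.conj_apply] using this
      refine ⟨c, ?_⟩
      rw [← e'.conj.apply_symm_apply f]
      simpa using congrArg e'.conj hc
  have hn1 : n = 1 := by
    refine Nat.eq_one_of_dvd_coprimes hcop ?_ hdvd
    rw [e'.finrank_eq, Module.finrank_pi_fintype]
    simp
  subst hn1
  rw [irreducible_iff_isSimpleModule_asModule]
  exact IsSimpleModule.congr (e.trans (LinearEquiv.funUnique (Fin 1) ℂ[N] S))

/-- If `G` is a finite group, `N ⊴ G`, and `χ ∈ Irr(G)` has degree `χ(1)` coprime to `|G/N|`,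
then the restriction of `χ` to `N` is irreducible. -/
theorem restriction_irreducible_of_coprime_degree
    {G : Type} [Group G] [Fintype G] (N : Subgroup G) [N.Normal]
    (V : FDRep ℂ G) (hV : Simple V)
    (hcop : Nat.Coprime (finrank ℂ V) N.index) :
    Simple (FDRep.res N V) := by
  have := V.isIrreducible_of_simple
  have := Representation.isIrreducible_comp_subtype_of_coprime N V.ρ hcop
  exact FDRep.simple_of_isIrreducible _
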